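/- (Pechenik) For every positive integer n and every integer k with 0 ≤ k ≤ n, the polynomial identity [n+1]_q · Σ_{T ∈ Inc_k(2×n)} q^{maj(T)} = q^{n+k(k+1)/2} · [n−1 choose k]_q · [2n−k choose n]_q holds in ℤ[q]. -/

import Mathlib

open Polynomial

/-- The q-integer `[n]_q = 1 + q + ⋯ + q^(n-1)` in `ℤ[q]`. -/
noncomputable def qInt (n : ℕ) : Polynomial ℤ := ∑ i ∈ Finset.range n, X ^ i

/-- The Gaussian binomial coefficient `[a choose b]_q` in `ℤ[q]`, defined by the
standard q-Pascal recurrence `[n+1 choose k+1] = [n choose k] + q^(k+1) [n choose k+1]`. -/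
noncomputable def qBinom : ℕ → ℕ → Polynomial ℤ
  | _, 0 => 1
  | 0, _ + 1 => 0
  | n + 1, k + 1 => qBinom n k + X ^ (k + 1) * qBinom n (k + 1)

/-- Major index: sum of all `i` such that `i` appears in row 1 and `i+1` appears in row 2. -/
def maj {n : ℕ} (T : (Fin n → ℕ) × (Fin n → ℕ)) : ℕ :=
  ∑ i ∈ (Finset.image T.1 Finset.univ).filter (fun i => ∃ j, T.2 j = i + 1), i

/-- Increasing tableaux of shape 2×n with entry set `{1, …, 2n−k}`:
rows and columns strictly increasing. -/
def Inc (n k : ℕ) : Set ((Fin n → ℕ) × (Fin n → ℕ)) :=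
  {T | StrictMono T.1 ∧ StrictMono T.2 ∧ (∀ i, T.1 i < T.2 i) ∧
    Set.range T.1 ∪ Set.range T.2 = Set.Icc 1 (2 * n - k)}
section alg
variable {K : Type*} [Field K]

def cc (q : K) (n : ℕ) : K := 1 - q ^ n
def ph (q : K) (n : ℕ) : K := ∏ i ∈ Finset.range n, cc q (i + 1)

lemma ph_succ (q : K) (n : ℕ) : ph q (n + 1) = ph q n * cc q (n + 1) := by
  simp [ph, Finset.prod_range_succ]

lemma ph_ne (q : K) (hq : ∀ n, cc q (n + 1) ≠ 0) (n : ℕ) : ph q n ≠ 0 := by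
  rw [ph, Finset.prod_ne_zero_iff]
  intro i _
  exact hq i

def EE (q : K) (r s k : ℕ) : K :=
  if k < s then q ^ (s + k * (k + 1) / 2) * cc q (r + 1 - s) * ph q (r + s - k) /
    (cc q (r + 1) * cc q s * ph q k * ph q (r - k) * ph q (s - k - 1)) else 0

def EM (q : K) (r s : ℕ) : ℕ → K
  | 0 => 0
  | k + 1 => EE q r s k

lemma EE_zero (q : K) (s k : ℕ) : EE q s (s + 1) k = 0 := by
  simp [EE, cc]

lemma EM_zero (q : K) (s k : ℕ) : EM q s (s + 1) k = 0 := by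
  cases k <;> simp [EM, EE_zero]

lemma EE_base (q : K) (hq : ∀ n, cc q (n + 1) ≠ 0) (r : ℕ) :
    EE q (r + 1) 1 0 - EE q r 1 0 = q ^ (r + 1) := by
  have h1 := hq r
  have h2 := hq (r + 1)
  have h0 := hq 0
  have h3 := ph_ne q hq r
  have h4 := ph_ne q hq 0
  simp only [EE, Nat.add_sub_cancel, Nat.sub_zero, ph_succ, Nat.sub_self]
  simp only [zero_add, Nat.lt_one_iff, if_true, zero_mul, Nat.zero_div, add_zero] at *
  generalize ph q r = p1 at *
  have h5 : ph q 0 = 1 := by simp [ph]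
  rw [h5]
  field_simp
  simp only [cc]
  ring

lemma EE_base' (q : K) (r k : ℕ) : EE q r 1 (k + 1) = 0 := by simp [EE]

lemma tri (k : ℕ) : (k + 1) * (k + 1 + 1) / 2 = k * (k + 1) / 2 + (k + 1) := by
  rw [show (k + 1) * (k + 1 + 1) = k * (k + 1) + (k + 1) * 2 by ring]
  rw [Nat.add_mul_div_right _ _ (by norm_num)]

lemma EE_rec (q : K) (hq : ∀ n, cc q (n + 1) ≠ 0) (r s k : ℕ) (hs : 1 ≤ s)
    (hr : s ≤ r) :
    EE q (r + 1) (s + 1) k - EE q r (s + 1) k =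
      EE q (r + 1) s k - EE q r s k + q ^ (r + 1 + s - k) * (EE q r s k + EM q r s k) := by
  rcases lt_trichotomy k s with h | h | h
  · obtain ⟨j, rfl⟩ := Nat.exists_eq_add_of_lt h
    obtain ⟨d, rfl⟩ := Nat.exists_eq_add_of_le hr
    cases k with
    | zero =>
      simp only [EM, EE]
      obtain ⟨N, hN⟩ : ∃ N, N = j + d + j + 2 := ⟨_, rfl⟩
      rw [if_pos (by omega), if_pos (by omega)]
      simp only [Nat.zero_add]
      rw [if_pos (by omega), if_pos (by omega),
        show j + 1 + d + 1 + 1 - (j + 1 + 1) = d + 1 by omega,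
        show j + 1 + d + 1 - (j + 1 + 1) = d by omega,
        show j + 1 + d + 1 + 1 - (j + 1) = d + 1 + 1 by omega,
        show j + 1 + d + 1 - (j + 1) = d + 1 by omega,
        show j + 1 + d + 1 + (j + 1 + 1) - 0 = N + 1 + 1 by omega,
        show j + 1 + d + (j + 1 + 1) - 0 = N + 1 by omega,
        show j + 1 + d + 1 + (j + 1) - 0 = N + 1 by omega,
        show j + 1 + d + (j + 1) - 0 = N by omega,
        show j + 1 + d + 1 - 0 = j + d + 1 + 1 by omega,
        show j + 1 + d - 0 = j + d + 1 by omega,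
        show j + 1 + 1 - 0 - 1 = j + 1 by omega,
        show j + 1 - 0 - 1 = j by omega]
      simp only [ph_succ]
      have a1 := ph_ne q hq j
      have a2 := ph_ne q hq (j + d)
      have a3 := ph_ne q hq N
      have a4 := ph_ne q hq 0
      have b1 := hq j
      have b2 := hq (j + 1)
      have b3 := hq (j + d)
      have b4 := hq (j + d + 1)
      have b5 := hq (j + d + 2)
      generalize ph q j = p1 at *
      generalize ph q (j + d) = p2 at *
      generalize ph q N = p3 at *
      generalize ph q 0 = p4 at *
      have e1 : cc q (j + 1 + d + 1) = cc q (j + d + 1 + 1) := by congr 1; ring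
      have e2 : cc q (j + 1 + d + 1 + 1) = cc q (j + d + 2 + 1) := by congr 1; ring
      simp only [e1, e2]
      field_simp
      simp only [cc, hN]
      ring
    | succ k =>
      simp only [EM, EE]
      rw [if_pos (by omega), if_pos (by omega), if_pos (by omega), if_pos (by omega),
        if_pos (by omega), tri]
      generalize k * (k + 1) / 2 = T
      obtain ⟨N, hN⟩ : ∃ N, N = k + j + d + j + 3 := ⟨_, rfl⟩
      rw [show k + 1 + j + 1 + d + 1 + 1 - (k + 1 + j + 1 + 1) = d + 1 by omega,
        show k + 1 + j + 1 + d + 1 - (k + 1 + j + 1 + 1) = d by omega,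
        show k + 1 + j + 1 + d + 1 + 1 - (k + 1 + j + 1) = d + 1 + 1 by omega,
        show k + 1 + j + 1 + d + 1 - (k + 1 + j + 1) = d + 1 by omega,
        show k + 1 + j + 1 + d + 1 + (k + 1 + j + 1 + 1) - (k + 1) = N + 1 + 1 by omega,
        show k + 1 + j + 1 + d + (k + 1 + j + 1 + 1) - (k + 1) = N + 1 by omega,
        show k + 1 + j + 1 + d + 1 + (k + 1 + j + 1) - (k + 1) = N + 1 by omega,
        show k + 1 + j + 1 + d + (k + 1 + j + 1) - (k + 1) = N by omega,
        show k + 1 + j + 1 + d + (k + 1 + j + 1) - k = N + 1 by omega,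
        show k + 1 + j + 1 + d + 1 - (k + 1) = j + d + 1 + 1 by omega,
        show k + 1 + j + 1 + d - (k + 1) = j + d + 1 by omega,
        show k + 1 + j + 1 + d - k = j + d + 1 + 1 by omega,
        show k + 1 + j + 1 + 1 - (k + 1) - 1 = j + 1 by omega,
        show k + 1 + j + 1 - (k + 1) - 1 = j by omega,
        show k + 1 + j + 1 - k - 1 = j + 1 by omega]
      simp only [ph_succ]
      have a1 := ph_ne q hq j
      have a2 := ph_ne q hq (j + d)
      have a3 := ph_ne q hq N
      have a4 := ph_ne q hq k
      have b1 := hq j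
      have b2 := hq k
      have b3 := hq (j + d)
      have b4 := hq (j + d + 1)
      have b5 := hq (k + j + d + 2)
      have b6 := hq (k + j + d + 3)
      have b7 := hq (k + j + 1)
      have b8 := hq (k + j + 2)
      generalize ph q j = p1 at *
      generalize ph q (j + d) = p2 at *
      generalize ph q N = p3 at *
      generalize ph q k = p4 at *
      have e1 : cc q (k + 1 + j + 1 + d + 1) = cc q (k + j + d + 2 + 1) := by congr 1; ring
      have e2 : cc q (k + 1 + j + 1 + d + 1 + 1) = cc q (k + j + d + 3 + 1) := by congr 1; ring
      have e3 : cc q (k + 1 + j + 1) = cc q (k + j + 1 + 1) := by congr 1; ring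
      have e4 : cc q (k + 1 + j + 1 + 1) = cc q (k + j + 2 + 1) := by congr 1; ring
      simp only [e1, e2, e3, e4]
      field_simp
      simp only [cc, hN]
      ring
  · subst h
    obtain ⟨d, rfl⟩ := Nat.exists_eq_add_of_le hr
    obtain ⟨k, rfl⟩ := Nat.exists_eq_add_of_le' hs
    simp only [EM, EE]
    rw [if_pos (by omega), if_pos (by omega), if_neg (by omega), if_neg (by omega),
        if_pos (by omega), tri]
    generalize k * (k + 1) / 2 = T
    obtain ⟨N, hN⟩ : ∃ N, N = k + d + 2 := ⟨_, rfl⟩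
    rw [show k + 1 + d + 1 + 1 - (k + 1 + 1) = d + 1 by omega,
        show k + 1 + d + 1 - (k + 1 + 1) = d by omega,
        show k + 1 + d + 1 - (k + 1) = d + 1 by omega,
        show k + 1 + d + 1 + (k + 1 + 1) - (k + 1) = N + 1 by omega,
        show k + 1 + d + (k + 1 + 1) - (k + 1) = N by omega,
        show k + 1 + d + 1 + (k + 1) - (k + 1) = N by omega,
        show k + 1 + d - (k + 1) = d by omega,
        show k + 1 + d + (k + 1) - k = N by omega,
        show k + 1 + d - k = d + 1 by omega,
        show k + 1 + 1 - (k + 1) - 1 = 0 by omega,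
        show k + 1 - k - 1 = 0 by omega]
    simp only [ph_succ]
    have a1 := ph_ne q hq d
    have a2 := ph_ne q hq 0
    have a3 := ph_ne q hq N
    have a4 := ph_ne q hq k
    have b1 := hq d
    have b2 := hq k
    have b3 := hq (k + 1)
    have b4 := hq (k + d + 1)
    have b5 := hq (k + d + 2)
    generalize ph q d = p1 at *
    generalize ph q 0 = p2 at *
    generalize ph q N = p3 at *
    generalize ph q k = p4 at *
    have e1 : cc q (k + 1 + d + 1) = cc q (k + d + 1 + 1) := by congr 1; ring
    have e2 : cc q (k + 1 + d + 1 + 1) = cc q (k + d + 2 + 1) := by congr 1; ring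
    simp only [e1, e2]
    field_simp
    simp only [cc, hN]
    ring
  · obtain ⟨k, rfl⟩ : ∃ j, k = j + 1 := ⟨k - 1, by omega⟩
    simp only [EM, EE]
    rw [if_neg (by omega), if_neg (by omega), if_neg (by omega), if_neg (by omega),
      if_neg (by omega)]
    ring
end alg

/-- the ballot condition and content of a pair of rows. -/
def Cond (m r s : ℕ) (A B : Finset ℕ) : Prop :=
  A ∪ B = Finset.Icc 1 m ∧ A.card = r ∧ B.card = s ∧
    ∀ v ∈ B, (B.filter (· ≤ v)).card ≤ (A.filter (· < v)).card

def mj (A B : Finset ℕ) : ℕ := ∑ i ∈ A.filter (fun i => i + 1 ∈ B), i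

section comb
variable {K : Type*} [Field K]
open Classical in
noncomputable def tot (q : K) (m r s : ℕ) : K :=
  ∑ A ∈ (Finset.Icc 1 m).powerset, ∑ B ∈ (Finset.Icc 1 m).powerset,
    if Cond m r s A B then q ^ mj A B else 0

open Classical in
noncomputable def wt (q : K) (m r s : ℕ) : K :=
  ∑ A ∈ (Finset.Icc 1 m).powerset, ∑ B ∈ (Finset.Icc 1 m).powerset,
    if Cond m r s A B then q ^ (mj A B + if m ∈ A then m else 0) else 0

lemma Icc_ins (m : ℕ) : Finset.Icc 1 (m + 1) = insert (m + 1) (Finset.Icc 1 m) := by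
  ext x; simp only [Finset.mem_Icc, Finset.mem_insert]; omega

lemma split4 (m : ℕ) (f : Finset ℕ → Finset ℕ → K) :
    ∑ A ∈ (Finset.Icc 1 (m + 1)).powerset, ∑ B ∈ (Finset.Icc 1 (m + 1)).powerset, f A B =
    ∑ A ∈ (Finset.Icc 1 m).powerset, ∑ B ∈ (Finset.Icc 1 m).powerset,
      (f A B + f A (insert (m + 1) B) + f (insert (m + 1) A) B +
        f (insert (m + 1) A) (insert (m + 1) B)) := by
  have hm : m + 1 ∉ Finset.Icc 1 m := by simp
  rw [Icc_ins, Finset.sum_powerset_insert hm]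
  simp only [Finset.sum_powerset_insert hm, Finset.sum_add_distrib]
  ring

lemma nm {m : ℕ} {A : Finset ℕ} (hA : A ⊆ Finset.Icc 1 m) {x : ℕ} (hx : x ∈ A) : x ≤ m :=
  (Finset.mem_Icc.1 (hA hx)).2

lemma nm' {m : ℕ} {A : Finset ℕ} (hA : A ⊆ Finset.Icc 1 m) : m + 1 ∉ A := fun h => by
  have := nm hA h; omega

lemma un_iff {m : ℕ} {A B C : Finset ℕ} (hA : A ⊆ Finset.Icc 1 m) (hB : B ⊆ Finset.Icc 1 m)
    (hC : C = insert (m + 1) (A ∪ B)) : C = Finset.Icc 1 (m + 1) ↔ A ∪ B = Finset.Icc 1 m := by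
  subst hC
  rw [Icc_ins]
  constructor
  · intro h
    have := congrArg (fun s => s.erase (m + 1)) h
    simpa [Finset.erase_insert, nm' hA, nm' hB] using this
  · intro h; rw [h]

variable {m r s : ℕ} {A B : Finset ℕ}

lemma cond_none (hA : A ⊆ Finset.Icc 1 m) (hB : B ⊆ Finset.Icc 1 m) :
    ¬ Cond (m + 1) r s A B := by
  rintro ⟨h, -⟩
  have : m + 1 ∈ A ∪ B := by rw [h]; simp
  rcases Finset.mem_union.1 this with h | h
  · exact nm' hA h
  · exact nm' hB h

lemma flt_lt {v : ℕ} (hv : v ≤ m) :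
    (insert (m + 1) A).filter (· < v) = A.filter (· < v) := by
  rw [Finset.filter_insert, if_neg (by omega)]

lemma flt_le {v : ℕ} (hv : v ≤ m) :
    (insert (m + 1) A).filter (· ≤ v) = A.filter (· ≤ v) := by
  rw [Finset.filter_insert, if_neg (by omega)]

lemma flt_lt' (hA : A ⊆ Finset.Icc 1 m) :
    (A.filter (· < m + 1)) = A := by
  apply Finset.filter_true_of_mem
  intro x hx; have := nm hA hx; omega

lemma flt_le' (hA : A ⊆ Finset.Icc 1 m) :
    ((insert (m + 1) A).filter (· ≤ m + 1)) = insert (m + 1) A := by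
  apply Finset.filter_true_of_mem
  intro x hx
  rcases Finset.mem_insert.1 hx with rfl | hx
  · exact le_rfl
  have := nm hA hx; omega

lemma cond_U (hA : A ⊆ Finset.Icc 1 m) (hB : B ⊆ Finset.Icc 1 m) :
    Cond (m + 1) r s (insert (m + 1) A) B ↔ 1 ≤ r ∧ Cond m (r - 1) s A B := by
  have h1 := un_iff hA hB (C := insert (m + 1) A ∪ B) (by simp)
  have h2 : (∀ v ∈ B, (B.filter (· ≤ v)).card ≤ ((insert (m + 1) A).filter (· < v)).card) ↔
      ∀ v ∈ B, (B.filter (· ≤ v)).card ≤ (A.filter (· < v)).card := by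
    refine forall₂_congr fun v hv => ?_
    rw [flt_lt (nm hB hv)]
  unfold Cond
  rw [h1, h2, Finset.card_insert_of_notMem (nm' hA)]
  constructor
  · rintro ⟨a, b, c, d⟩; exact ⟨by omega, a, by omega, c, d⟩
  · rintro ⟨e, a, b, c, d⟩; exact ⟨a, by omega, c, d⟩

lemma cond_D (hA : A ⊆ Finset.Icc 1 m) (hB : B ⊆ Finset.Icc 1 m) :
    Cond (m + 1) r s A (insert (m + 1) B) ↔ (1 ≤ s ∧ s ≤ r) ∧ Cond m r (s - 1) A B := by
  have h1 := un_iff hA hB (C := A ∪ insert (m + 1) B) (by simp)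
  have h2 : (∀ v ∈ insert (m + 1) B,
        ((insert (m + 1) B).filter (· ≤ v)).card ≤ (A.filter (· < v)).card) ↔
      B.card + 1 ≤ A.card ∧ ∀ v ∈ B, (B.filter (· ≤ v)).card ≤ (A.filter (· < v)).card := by
    rw [Finset.forall_mem_insert, flt_le' hB, flt_lt' hA, Finset.card_insert_of_notMem (nm' hB)]
    refine and_congr_right fun _ => forall₂_congr fun v hv => ?_
    rw [flt_le (nm hB hv)]
  unfold Cond
  rw [h1, h2, Finset.card_insert_of_notMem (nm' hB)]
  constructor
  · rintro ⟨a, b, c, d, e⟩; exact ⟨by omega, a, by omega, by omega, e⟩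
  · rintro ⟨e, a, b, c, d⟩; exact ⟨a, by omega, by omega, by omega, d⟩

lemma cond_B (hA : A ⊆ Finset.Icc 1 m) (hB : B ⊆ Finset.Icc 1 m) :
    Cond (m + 1) r s (insert (m + 1) A) (insert (m + 1) B) ↔
      (1 ≤ s ∧ s + 1 ≤ r) ∧ Cond m (r - 1) (s - 1) A B := by
  have h1 := un_iff hA hB (C := insert (m + 1) A ∪ insert (m + 1) B) (by ext; simp)
  have h2 : (∀ v ∈ insert (m + 1) B,
        ((insert (m + 1) B).filter (· ≤ v)).card ≤ ((insert (m + 1) A).filter (· < v)).card) ↔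
      B.card + 1 ≤ A.card ∧ ∀ v ∈ B, (B.filter (· ≤ v)).card ≤ (A.filter (· < v)).card := by
    rw [Finset.forall_mem_insert, flt_le' hB, Finset.filter_insert, if_neg (by omega),
      flt_lt' hA, Finset.card_insert_of_notMem (nm' hB)]
    refine and_congr_right fun _ => forall₂_congr fun v hv => ?_
    rw [flt_le (nm hB hv), flt_lt (nm hB hv)]
  unfold Cond
  rw [h1, h2, Finset.card_insert_of_notMem (nm' hB), Finset.card_insert_of_notMem (nm' hA)]
  constructor
  · rintro ⟨a, b, c, d, e⟩; exact ⟨by omega, a, by omega, by omega, e⟩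
  · rintro ⟨e, a, b, c, d⟩; exact ⟨a, by omega, by omega, by omega, d⟩

lemma mj_U (hB : B ⊆ Finset.Icc 1 m) : mj (insert (m + 1) A) B = mj A B := by
  unfold mj
  rw [Finset.filter_insert, if_neg]
  intro h
  have := nm hB h
  omega

lemma mj_D (hA : A ⊆ Finset.Icc 1 m) (hB : B ⊆ Finset.Icc 1 m) :
    mj A (insert (m + 1) B) = mj A B + if m ∈ A then m else 0 := by
  unfold mj
  by_cases h : m ∈ A
  · have : A.filter (fun i => i + 1 ∈ insert (m + 1) B) =
        insert m (A.filter (fun i => i + 1 ∈ B)) := by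
      ext x
      simp only [Finset.mem_filter, Finset.mem_insert, add_left_inj]
      constructor
      · rintro ⟨a, b | b⟩ <;> tauto
      · rintro (rfl | b) <;> tauto
    rw [this, Finset.sum_insert, if_pos h, add_comm]
    intro h'
    exact nm' hB (Finset.mem_filter.1 h').2
  · rw [if_neg h, add_zero]
    congr 1
    apply Finset.filter_congr
    intro x hx
    simp only [Finset.mem_insert, add_left_inj]
    constructor
    · rintro (rfl | b)
      · exact absurd hx h
      · exact b
    · exact Or.inr

lemma mj_B (hA : A ⊆ Finset.Icc 1 m) (hB : B ⊆ Finset.Icc 1 m) :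
    mj (insert (m + 1) A) (insert (m + 1) B) = mj A B + if m ∈ A then m else 0 := by
  rw [← mj_D hA hB]
  unfold mj
  rw [Finset.filter_insert, if_neg]
  intro h
  rcases Finset.mem_insert.1 h with h | h
  · omega
  have := nm hB h
  omega

lemma tot_succ (q : K) (m r s : ℕ) : tot q (m + 1) r s =
    (if 1 ≤ r then tot q m (r - 1) s else 0) +
    (if 1 ≤ s ∧ s ≤ r then wt q m r (s - 1) else 0) +
    (if 1 ≤ s ∧ s + 1 ≤ r then wt q m (r - 1) (s - 1) else 0) := by
  classical
  have key : ∀ (p : Prop) [Decidable p] (f : Finset ℕ → Finset ℕ → K),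
      (if p then ∑ A ∈ (Finset.Icc 1 m).powerset, ∑ B ∈ (Finset.Icc 1 m).powerset, f A B else 0)
       = ∑ A ∈ (Finset.Icc 1 m).powerset, ∑ B ∈ (Finset.Icc 1 m).powerset,
        if p then f A B else 0 := by
    intro p _ f; split_ifs <;> simp
  unfold tot wt
  rw [split4]
  simp only [key]
  simp only [← Finset.sum_add_distrib]
  refine Finset.sum_congr rfl fun A hA => Finset.sum_congr rfl fun B hB => ?_
  rw [Finset.mem_powerset] at hA hB
  rw [if_neg (cond_none hA hB)]
  simp only [cond_U hA hB, cond_D hA hB, cond_B hA hB, mj_U hB, mj_D hA hB, mj_B hA hB,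
    ← ite_and]
  ring

lemma wt_succ (q : K) (m r s : ℕ) : wt q (m + 1) r s =
    q ^ (m + 1) * ((if 1 ≤ r then tot q m (r - 1) s else 0) +
      (if 1 ≤ s ∧ s + 1 ≤ r then wt q m (r - 1) (s - 1) else 0)) +
    (if 1 ≤ s ∧ s ≤ r then wt q m r (s - 1) else 0) := by
  classical
  have key : ∀ (p : Prop) [Decidable p] (f : Finset ℕ → Finset ℕ → K),
      (if p then ∑ A ∈ (Finset.Icc 1 m).powerset, ∑ B ∈ (Finset.Icc 1 m).powerset, f A B else 0)
       = ∑ A ∈ (Finset.Icc 1 m).powerset, ∑ B ∈ (Finset.Icc 1 m).powerset,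
        if p then f A B else 0 := by
    intro p _ f; split_ifs <;> simp
  unfold tot wt
  rw [split4]
  simp only [key]
  simp only [← Finset.sum_add_distrib, Finset.mul_sum]
  refine Finset.sum_congr rfl fun A hA => Finset.sum_congr rfl fun B hB => ?_
  rw [Finset.mem_powerset] at hA hB
  rw [if_neg (cond_none hA hB)]
  simp only [cond_U hA hB, cond_D hA hB, cond_B hA hB, mj_U hB, mj_D hA hB, mj_B hA hB,
    ← ite_and, if_neg (nm' hA), Finset.mem_insert_self, if_true, mul_add, mul_ite, mul_zero,
    add_zero, ← pow_add, zero_add]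
  simp only [add_comm, add_left_comm]
  ring

lemma tot_zero (q : K) (r s : ℕ) : tot q 0 r s = if r = 0 ∧ s = 0 then 1 else 0 := by
  simp only [tot, Finset.Icc_eq_empty_of_lt one_pos, Finset.powerset_empty, Finset.sum_singleton]
  simp [Cond, mj, eq_comm (a := 0)]

lemma wt_zero (q : K) (r s : ℕ) : wt q 0 r s = if r = 0 ∧ s = 0 then 1 else 0 := by
  simp only [wt, Finset.Icc_eq_empty_of_lt one_pos, Finset.powerset_empty, Finset.sum_singleton]
  simp [Cond, mj, eq_comm (a := 0)]

lemma van (q : K) (m : ℕ) : ∀ r s, (r + s < m ∨ r < s) → tot q m r s = 0 ∧ wt q m r s = 0 := by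
  induction m with
  | zero =>
    intro r s h
    rw [tot_zero, wt_zero, if_neg (by omega)]; simp
  | succ m ih =>
    intro r s h
    have h1 : (if 1 ≤ r then tot q m (r - 1) s else 0) = 0 := by
      split_ifs
      · exact (ih _ _ (by omega)).1
      · rfl
    have h2 : (if 1 ≤ s ∧ s ≤ r then wt q m r (s - 1) else 0) = 0 := by
      split_ifs
      · exact (ih _ _ (by omega)).2
      · rfl
    have h3 : (if 1 ≤ s ∧ s + 1 ≤ r then wt q m (r - 1) (s - 1) else 0) = 0 := by
      split_ifs
      · exact (ih _ _ (by omega)).2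
      · rfl
    rw [tot_succ, wt_succ, h1, h2, h3]
    simp
end comb

section mainind
variable {K : Type*} [Field K]

lemma EE_big (q : K) (r s k : ℕ) (h : s ≤ k) : EE q r s k = 0 := by
  rw [EE, if_neg (by omega)]

lemma EM_big (q : K) (r s k : ℕ) (h : s < k) : EM q r s k = 0 := by
  obtain ⟨j, rfl⟩ : ∃ j, k = j + 1 := ⟨k - 1, by omega⟩
  exact EE_big q r s j (by omega)

lemma main_ind (q : K) (hq : ∀ n, cc q (n + 1) ≠ 0) (m : ℕ) : ∀ r s k, m + k = r + s →
    (1 ≤ s → s ≤ r → tot q m r s = EE q r s k + EM q (r - 1) s k) ∧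
    (s < r → wt q m r s = EE q r (s + 1) k - EE q (r - 1) (s + 1) k) ∧
    (s = 0 → tot q m r s = if k = 0 then 1 else 0) := by
  induction m with
  | zero =>
    intro r s k h
    refine ⟨fun h1 h2 => ?_, fun h1 => ?_, fun h1 => ?_⟩
    · rw [tot_zero, if_neg (by omega), EE_big _ _ _ _ (by omega), EM_big _ _ _ _ (by omega),
        add_zero]
    · rw [wt_zero, if_neg (by omega), EE_big _ _ _ _ (by omega), EE_big _ _ _ _ (by omega),
        sub_zero]
    · subst h1
      rw [tot_zero]
      congr 1
      simp only [and_true, eq_iff_iff]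
      omega
  | succ m ih =>
    intro r s k h
    have hB : ∀ r' s', r = r' + 1 → s = s' + 1 → s' < r' →
        wt q m r' s' = EM q r' (s' + 1) k - EM q (r' - 1) (s' + 1) k := by
      rintro r' s' rfl rfl hlt
      cases k with
      | zero => simp [EM, (van q m r' s' (by omega)).2]
      | succ k => exact (ih r' s' k (by omega)).2.1 hlt
    refine ⟨fun h1 h2 => ?_, fun h1 => ?_, fun h1 => ?_⟩
    · obtain ⟨r, rfl⟩ : ∃ j, r = j + 1 := ⟨r - 1, by omega⟩
      obtain ⟨s, rfl⟩ : ∃ j, s = j + 1 := ⟨s - 1, by omega⟩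
      rw [tot_succ, if_pos (by omega), if_pos (by omega)]
      simp only [Nat.add_sub_cancel]
      rw [(ih (r + 1) s k (by omega)).2.1 (by omega)]
      rcases Nat.lt_or_ge s r with h3 | h3
      · rw [if_pos (by omega), hB r s rfl rfl h3, (ih r (s + 1) k (by omega)).1 (by omega) h3]
        simp only [Nat.add_sub_cancel]
        ring
      · obtain rfl : r = s := by omega
        rw [if_neg (by omega), (van q m r (r + 1) (by omega)).1]
        simp only [Nat.add_sub_cancel, EE_zero, EM_zero]
        ring
    · obtain ⟨r, rfl⟩ : ∃ j, r = j + 1 := ⟨r - 1, by omega⟩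
      rw [wt_succ, if_pos (by omega)]
      simp only [Nat.add_sub_cancel]
      cases s with
      | zero =>
        rw [if_neg (by omega), if_neg (by omega), (ih r 0 k (by omega)).2.2 rfl]
        cases k with
        | zero =>
          rw [EE_base q hq]
          obtain rfl : m = r := by omega
          simp
        | succ k => simp [EE_base']
      | succ s =>
        rw [if_pos (by omega), if_pos (by omega)]
        simp only [Nat.add_sub_cancel]
        rw [(ih (r + 1) s k (by omega)).2.1 (by omega), hB r s rfl rfl (by omega),
          (ih r (s + 1) k (by omega)).1 (by omega) (by omega),
          EE_rec q hq r (s + 1) k (by omega) (by omega),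
          show r + 1 + (s + 1) - k = m + 1 by omega]
        simp only [Nat.add_sub_cancel]
        ring
    · subst h1
      obtain ⟨r, rfl⟩ : ∃ j, r = j + 1 := ⟨r - 1, by omega⟩
      rw [tot_succ, if_pos (by omega), if_neg (by omega), if_neg (by omega)]
      simp only [Nat.add_sub_cancel]
      rw [(ih r 0 k (by omega)).2.2 rfl]
      simp
end mainind

section tableaux

lemma ballot_iff {n : ℕ} {a b : Fin n → ℕ} (ha : StrictMono a) (hb : StrictMono b) :
    (∀ i, a i < b i) ↔ ∀ v ∈ Finset.image b Finset.univ,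
      ((Finset.image b Finset.univ).filter (· ≤ v)).card ≤
        ((Finset.image a Finset.univ).filter (· < v)).card := by
  have e1 : ∀ i, (Finset.image b Finset.univ).filter (· ≤ b i) = Finset.image b (Finset.Iic i) := by
    intro i
    ext x
    simp only [Finset.mem_filter, Finset.mem_image, Finset.mem_univ, true_and, Finset.mem_Iic]
    constructor
    · rintro ⟨⟨j, rfl⟩, h⟩; exact ⟨j, hb.le_iff_le.1 h, rfl⟩
    · rintro ⟨j, h, rfl⟩; exact ⟨⟨j, rfl⟩, hb.le_iff_le.2 h⟩
  have e2 : ∀ i, ((Finset.image b Finset.univ).filter (· ≤ b i)).card = (i : ℕ) + 1 := by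
    intro i
    rw [e1, Finset.card_image_of_injective _ hb.injective, Fin.card_Iic]
  constructor
  · intro h v hv
    obtain ⟨i, -, rfl⟩ := Finset.mem_image.1 hv
    rw [e2]
    have : Finset.image a (Finset.Iic i) ⊆ (Finset.image a Finset.univ).filter (· < b i) := by
      intro x hx
      obtain ⟨j, hj, rfl⟩ := Finset.mem_image.1 hx
      rw [Finset.mem_filter]
      exact ⟨Finset.mem_image_of_mem _ (Finset.mem_univ _),
        (ha.le_iff_le.2 (Finset.mem_Iic.1 hj)).trans_lt (h i)⟩
    have := Finset.card_le_card this
    rwa [Finset.card_image_of_injective _ ha.injective, Fin.card_Iic] at this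
  · intro h i
    by_contra hc
    have h1 := h (b i) (Finset.mem_image_of_mem _ (Finset.mem_univ _))
    rw [e2] at h1
    have : (Finset.image a Finset.univ).filter (· < b i) ⊆ Finset.image a (Finset.Iio i) := by
      intro x hx
      obtain ⟨hx, hlt⟩ := Finset.mem_filter.1 hx
      obtain ⟨j, -, rfl⟩ := Finset.mem_image.1 hx
      refine Finset.mem_image_of_mem _ (Finset.mem_Iio.2 (ha.lt_iff_lt.1 ?_))
      omega
    have := Finset.card_le_card this
    rw [Finset.card_image_of_injective _ ha.injective, Fin.card_Iio] at this
    omega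

def toPair {n : ℕ} (T : (Fin n → ℕ) × (Fin n → ℕ)) : Finset ℕ × Finset ℕ :=
  (Finset.image T.1 Finset.univ, Finset.image T.2 Finset.univ)

lemma maj_eq {n : ℕ} (T : (Fin n → ℕ) × (Fin n → ℕ)) :
    maj T = mj (toPair T).1 (toPair T).2 := by
  unfold maj mj toPair
  congr 1
  apply Finset.filter_congr
  intro x _
  simp

lemma inc_iff {n k : ℕ} {T : (Fin n → ℕ) × (Fin n → ℕ)} (h1 : StrictMono T.1)
    (h2 : StrictMono T.2) : T ∈ Inc n k ↔ Cond (2 * n - k) n n (toPair T).1 (toPair T).2 := by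
  have e : Set.range T.1 ∪ Set.range T.2 = Set.Icc 1 (2 * n - k) ↔
      (toPair T).1 ∪ (toPair T).2 = Finset.Icc 1 (2 * n - k) := by
    rw [← Finset.coe_inj]
    simp [toPair]
  unfold Inc Cond
  rw [Set.mem_ofPred_eq, e, ballot_iff h1 h2]
  simp only [toPair, Finset.card_image_of_injective _ h1.injective,
    Finset.card_image_of_injective _ h2.injective, Finset.card_univ, Fintype.card_fin]
  tauto

lemma strictMono_image_inj {n : ℕ} {a b : Fin n → ℕ} (ha : StrictMono a) (hb : StrictMono b)
    (h : Finset.image a Finset.univ = Finset.image b Finset.univ) : a = b := by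
  apply (StrictMono.range_inj ha hb).1
  have := congrArg (fun s : Finset ℕ => (s : Set ℕ)) h
  simpa using this

lemma bij (n k : ℕ) : Set.BijOn toPair (Inc n k)
    {p : Finset ℕ × Finset ℕ | Cond (2 * n - k) n n p.1 p.2} := by
  refine ⟨fun T hT => (inc_iff hT.1 hT.2.1).1 hT, ?_, ?_⟩
  · intro T hT S hS h
    have h' := Prod.mk_inj.1 h
    exact Prod.ext (strictMono_image_inj hT.1 hS.1 h'.1)
      (strictMono_image_inj hT.2.1 hS.2.1 h'.2)
  · rintro ⟨A, B⟩ hp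
    have hp' : Cond (2 * n - k) n n A B := hp
    have hA := hp'.2.1
    have hB := hp'.2.2.1
    have ha := (A.orderEmbOfFin hA).strictMono
    have hb := (B.orderEmbOfFin hB).strictMono
    have e : toPair ((A.orderEmbOfFin hA : Fin n → ℕ), (B.orderEmbOfFin hB : Fin n → ℕ)) = (A, B) := by
      simp [toPair]
    refine ⟨((A.orderEmbOfFin hA : Fin n → ℕ), (B.orderEmbOfFin hB : Fin n → ℕ)), ?_, e⟩
    rw [inc_iff ha hb, e]
    exact hp'

open Classical in
lemma finsum_eq {R : Type*} [CommSemiring R] (x : R) (n k : ℕ) :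
    ∑ᶠ T ∈ Inc n k, x ^ maj T =
      ∑ A ∈ (Finset.Icc 1 (2 * n - k)).powerset, ∑ B ∈ (Finset.Icc 1 (2 * n - k)).powerset,
        if Cond (2 * n - k) n n A B then x ^ mj A B else 0 := by
  rw [finsum_mem_eq_of_bijOn (g := fun p : Finset ℕ × Finset ℕ => x ^ mj p.1 p.2) toPair (bij n k)
    (fun T _ => by rw [maj_eq])]
  rw [← Finset.sum_product', ← Finset.sum_filter, ← finsum_mem_coe_finset]
  refine finsum_mem_congr ?_ fun _ _ => rfl
  ext p
  simp only [Set.mem_ofPred_eq, Finset.coe_filter, Finset.mem_product, Finset.mem_powerset]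
  constructor
  · intro h
    refine ⟨⟨?_, ?_⟩, h⟩
    · rw [← h.1]; exact Finset.subset_union_left
    · rw [← h.1]; exact Finset.subset_union_right
  · exact fun h => h.2
end tableaux

section gauss
variable {K : Type*} [Field K]

lemma qBinom_big : ∀ n k, n < k → qBinom n k = 0
  | 0, k + 1, _ => by simp [qBinom]
  | n + 1, k + 1, h => by
    rw [qBinom, qBinom_big n k (by omega), qBinom_big n (k + 1) (by omega)]; simp

lemma qBinom_zero (n : ℕ) : qBinom n 0 = 1 := by cases n <;> simp [qBinom]

lemma qBinom_ph (f : ℤ[X] →+* K) (N : ℕ) : ∀ a b, a + b = N →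
    f (qBinom N b) * ph (f X) b * ph (f X) a = ph (f X) N := by
  induction N with
  | zero =>
    intro a b h
    obtain rfl : a = 0 := by omega
    obtain rfl : b = 0 := by omega
    simp [qBinom_zero, ph]
  | succ N ih =>
    intro a b h
    cases b with
    | zero =>
      obtain rfl : a = N + 1 := by omega
      simp [qBinom_zero, ph]
    | succ b =>
      rw [qBinom]
      cases a with
      | zero =>
        obtain rfl : b = N := by omega
        rw [qBinom_big b (b + 1) (by omega)]
        have := ih 0 b (by omega)
        simp only [ph_succ, mul_zero, add_zero]
        linear_combination cc (f X) (b + 1) * this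
      | succ a =>
        have h1 := ih (a + 1) b (by omega)
        have h2 := ih a (b + 1) (by omega)
        obtain rfl : N = a + b + 1 := by omega
        simp only [map_add, map_mul, map_pow]
        have e : cc (f X) (a + b + 1 + 1) =
            cc (f X) (b + 1) + (f X) ^ (b + 1) * cc (f X) (a + 1) := by
          simp only [cc]; ring
        rw [ph_succ (f X) (a + b + 1), e]
        rw [ph_succ (f X) a] at h1 ⊢
        rw [ph_succ (f X) b] at h2 ⊢
        linear_combination cc (f X) (b + 1) * h1 + (f X) ^ (b + 1) * cc (f X) (a + 1) * h2

lemma qInt_cc (f : ℤ[X] →+* K) (n : ℕ) : f (qInt n) * cc (f X) 1 = cc (f X) n := by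
  simp only [qInt, cc, map_sum, map_pow, pow_one]
  have := geom_sum_mul (f X) n
  linear_combination - this
end gauss

/-- (Pechenik) [n+1]_q · Σ_{T ∈ Inc_k(2×n)} q^maj(T)
      = q^(n + k(k+1)/2) · [n−1 choose k]_q · [2n−k choose n]_q. -/
theorem sqnk (n k : ℕ) (hn : 1 ≤ n) (hk : k ≤ n) :
    qInt (n + 1) * ∑ᶠ T ∈ Inc n k, (X : Polynomial ℤ) ^ maj T
      = X ^ (n + k * (k + 1) / 2) * (qBinom (n - 1) k * qBinom (2 * n - k) n) := by
  classical
  have hinj : Function.Injective (algebraMap ℤ[X] (FractionRing ℤ[X])) :=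
    IsFractionRing.injective _ _
  generalize algebraMap ℤ[X] (FractionRing ℤ[X]) = f at hinj
  have hq : ∀ j, cc (f X) (j + 1) ≠ 0 := by
    intro j h
    have h1 : f (1 - X ^ (j + 1)) = f 0 := by
      simpa [cc] using h
    have h2 := congrArg (Polynomial.eval 0) (hinj h1)
    simp at h2
  apply hinj
  have hs : f (∑ᶠ T ∈ Inc n k, (X : Polynomial ℤ) ^ maj T) = EE (f X) n n k := by
    rw [finsum_eq]
    have : f (∑ A ∈ (Finset.Icc 1 (2 * n - k)).powerset,
        ∑ B ∈ (Finset.Icc 1 (2 * n - k)).powerset,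
        if Cond (2 * n - k) n n A B then X ^ mj A B else 0) = tot (f X) (2 * n - k) n n := by
      unfold tot
      simp only [map_sum, apply_ite f, map_pow, map_zero]
    rw [this, (main_ind (f X) hq (2 * n - k) n n k (by omega)).1 hn le_rfl]
    obtain ⟨j, rfl⟩ : ∃ j, n = j + 1 := ⟨n - 1, by omega⟩
    simp [EM_zero]
  rw [map_mul, hs]
  simp only [map_mul, map_pow]
  rcases Nat.lt_or_ge k n with h | h
  · have c1 := qInt_cc f (n + 1)
    have c2 := qBinom_ph f (n - 1) (n - 1 - k) k (by omega)
    have c3 := qBinom_ph f (2 * n - k) (n - k) n (by omega)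
    rw [EE, if_pos h, show n + 1 - n = 1 by omega, show n + n - k = 2 * n - k by omega,
      show n - k - 1 = n - 1 - k by omega, ← c1, ← c3]
    have hn' : ph (f X) n = f (qBinom (n - 1) k) * ph (f X) k * ph (f X) (n - 1 - k) *
        cc (f X) n := by
      rw [c2]
      obtain ⟨j, rfl⟩ : ∃ j, n = j + 1 := ⟨n - 1, by omega⟩
      exact ph_succ _ _
    rw [hn']
    have d1 : f (qInt (n + 1)) ≠ 0 := by
      intro h0
      rw [h0, zero_mul] at c1
      exact hq n c1.symm
    have d2 := hq 0
    have d3 := hq (n - 1)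
    rw [Nat.sub_add_cancel hn] at d3
    rw [zero_add] at d2
    have p1 := ph_ne (f X) hq k
    have p2 := ph_ne (f X) hq (n - k)
    have p3 := ph_ne (f X) hq (n - 1 - k)
    field_simp
  · rw [EE_big _ _ _ _ h, qBinom_big (n - 1) k (by omega)]
    simp
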